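/- arXiv:2604.27173 — 2 statements merged into one kernel-verified Lean document; each statement's English description precedes it below -/
import Mathlib

section
/- Let S be a finite nonempty type, n ≥ 1, p : S → ℝ a probability distribution (p(s) ≥ 0, Σ_s p(s) = 1), and for each stage k ∈ Fin n let P_k : X_k → S → Y → ℝ be conditional probabilities. Consider the joint Hilbert space ℂ^{(Fin n → S)} with the matrix ρ = Σ_s p(s) · |s,…,s⟩⟨s,…,s|, i.e. ρ(f,g) = p(s) if f = g = (the constant function s) for some s ∈ S, and ρ(f,g) = 0 otherwise. Fix outcomes x_k ∈ X_k and information values y_k ∈ Y, and let M_k ∈ Matrix S S ℂ be the diagonal matrix with entries M_k(s,s) = P_k(x_k | s, y_k). Let O ∈ Matrix (Fin n → S) (Fin n → S) ℂ be the tensor-product operator O(f,g) = Π_{k} M_k(f(k), g(k)). Then Tr[O · ρ] = Σ_s p(s) · Π_{k=1}^{n} P_k(x_k | s, y_k). In particular, every distribution of the form P*(x₁,…,x_n) = Σ_s p(s) Π_k P_k(x_k | s, y_k) is implemented by local quantum measurements on the shared separable state ρ, without the latent variable s being accessible through the information variables. -/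
open Matrix

/-- Main identity of Theorem 1: on the joint space `ℂ^(Fin n → S)`, with shared
separable state `ρ = Σ_s p(s) |s,…,s⟩⟨s,…,s|` and the tensor-product operator `O`
built from the diagonal local measurement operators `M_k = diag(P_k(x_k | s, y_k))_s`,
one has `Tr[O ρ] = Σ_s p(s) Π_k P_k(x_k | s, y_k)`. Hence every latent-variable
distribution `P*(x₁,…,x_n) = Σ_s p(s) Π_k P_k(x_k|s,y_k)` is implemented by local
quantum measurements on `ρ`, without the latent variable `s` being accessible. -/
theorem latent_variable_distribution_implemented_by_separable_state
    {n : ℕ} (hn : 1 ≤ n) (S : Type) [Fintype S] [Nonempty S] [DecidableEq S]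
    (Y : Type) (X : Fin n → Type) [∀ k, Fintype (X k)]
    (p : S → ℝ) (hp : ∀ s, 0 ≤ p s) (hp1 : ∑ s, p s = 1)
    (P : ∀ k : Fin n, X k → S → Y → ℝ)
    (hPnn : ∀ k x s y, 0 ≤ P k x s y)
    (hPsum : ∀ k s y, ∑ x : X k, P k x s y = 1)
    (x : ∀ k, X k) (y : Fin n → Y) :
    let e : S → (Fin n → S) → ℂ :=
      fun s f => if f = Function.const (Fin n) s then 1 else 0
    let ρ : Matrix (Fin n → S) (Fin n → S) ℂ :=
      ∑ s, (p s : ℂ) • Matrix.vecMulVec (e s) (star (e s))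
    let M : ∀ _ : Fin n, Matrix S S ℂ :=
      fun k => Matrix.diagonal fun s => (P k (x k) s (y k) : ℂ)
    let O : Matrix (Fin n → S) (Fin n → S) ℂ :=
      Matrix.of fun f g => ∏ k, M k (f k) (g k)
    Matrix.trace (O * ρ) = ∑ s, (p s : ℂ) * ∏ k, (P k (x k) s (y k) : ℂ) := by
  intro e ρ M O
  have he : ∀ s, e s = Pi.single (Function.const (Fin n) s) (1 : ℂ) := by
    intro s
    funext f
    simp [e, Pi.single_apply]
  have hs : ∀ s, star (e s) = e s := by
    intro s
    funext f
    by_cases h : f = Function.const (Fin n) s <;> simp [e, h]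
  simp only [ρ, Matrix.mul_sum, Matrix.trace_sum, Matrix.mul_smul, Matrix.trace_smul, smul_eq_mul]
  refine Finset.sum_congr rfl fun s _ => ?_
  congr 1
  rw [hs, Matrix.mul_vecMulVec, Matrix.trace_vecMulVec, he]
  simp [O, M]
end

section
/- Let S, X₁, X₂ be finite types, p : S → ℝ a probability distribution, g : S → X₁ and h : S → X₂ functions, {|s⟩}_{s∈S} an orthonormal family in ℂ^{d_A}, and {|φ_s⟩}_{s∈S} a family of unit vectors in ℂ^{d_B}. Suppose {M_{x₂}}_{x₂∈X₂} is a family of matrices on ℂ^{d_B} satisfying ⟨φ_s| M_{x₂} |φ_s⟩ = 1 if x₂ = h(s) and 0 otherwise, for all s ∈ S. Define the separable state ρ_{AB} = Σ_s p(s) · |s⟩⟨s| ⊗ |φ_s⟩⟨φ_s| on ℂ^{d_A} ⊗ ℂ^{d_B}, and the stage-1 operators M^{(1)}_{x₁} = Σ_{s : g(s) = x₁} |s⟩⟨s|. Then for all x₁ ∈ X₁ and x₂ ∈ X₂: Tr[(M^{(1)}_{x₁} ⊗ M_{x₂}) ρ_{AB}] = Σ_{s : g(s) = x₁ and h(s)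 = x₂} p(s). Equivalently, the induced joint distribution equals P*(x₁,x₂) = Σ_s p(s) δ_{x₁,g(s)} δ_{x₂,h(s)}. -/
open Matrix Kronecker

/-- Main trace identity of Theorem 2: with the separable state
`ρ_{AB} = Σ_s p(s) |s⟩⟨s| ⊗ |φ_s⟩⟨φ_s|`, stage-1 operators
`M^{(1)}_{x₁} = Σ_{s : g(s)=x₁} |s⟩⟨s|`, and a fixed stage-2 measurement `{M_{x₂}}`
with `⟨φ_s|M_{x₂}|φ_s⟩ = δ_{x₂, h(s)}`, the induced joint distribution is
`Tr[(M^{(1)}_{x₁} ⊗ M_{x₂}) ρ_{AB}] = Σ_{s : g(s)=x₁ ∧ h(s)=x₂} p(s)`,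
i.e. it equals `P*(x₁,x₂) = Σ_s p(s) δ_{x₁,g(s)} δ_{x₂,h(s)}`. -/
theorem discordant_hidden_coordination_trace_identity
    (S X₁ X₂ : Type) [Fintype S] [DecidableEq S]
    [Fintype X₁] [DecidableEq X₁] [Fintype X₂] [DecidableEq X₂]
    (dA dB : ℕ)
    (p : S → ℝ) (hp : ∀ s, 0 ≤ p s) (hp1 : ∑ s, p s = 1)
    (g : S → X₁) (h : S → X₂)
    (v : S → Fin dA → ℂ)
    (horth : ∀ s s', star (v s) ⬝ᵥ v s' = if s = s' then 1 else 0)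
    (φ : S → Fin dB → ℂ) (hφ : ∀ s, star (φ s) ⬝ᵥ φ s = 1)
    (M : X₂ → Matrix (Fin dB) (Fin dB) ℂ)
    (hM : ∀ s x₂, star (φ s) ⬝ᵥ (M x₂).mulVec (φ s) = if x₂ = h s then 1 else 0)
    (x₁ : X₁) (x₂ : X₂) :
    Matrix.trace
      (((∑ s ∈ Finset.univ.filter (fun s => g s = x₁),
            Matrix.vecMulVec (v s) (star (v s))) ⊗ₖ M x₂) *
        (∑ s, (p s : ℂ) •
          (Matrix.vecMulVec (v s) (star (v s)) ⊗ₖ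
            Matrix.vecMulVec (φ s) (star (φ s))))) =
      ∑ s ∈ Finset.univ.filter (fun s => g s = x₁ ∧ h s = x₂), (p s : ℂ) := by
  have key : ∀ s, Matrix.trace ((∑ t ∈ Finset.univ.filter (fun s => g s = x₁),
      Matrix.vecMulVec (v t) (star (v t))) * Matrix.vecMulVec (v s) (star (v s))) =
      if g s = x₁ then 1 else 0 := by
    intro s
    rw [Matrix.mul_vecMulVec, Matrix.trace_vecMulVec, Matrix.sum_mulVec, sum_dotProduct]
    have : ∀ t, (Matrix.vecMulVec (v t) (star (v t))).mulVec (v s) ⬝ᵥ star (v s) =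
        if t = s then 1 else 0 := by
      intro t
      rw [dotProduct_comm, Matrix.dotProduct_mulVec, Matrix.vecMul_vecMulVec, smul_dotProduct,
        horth, horth]
      by_cases hts : t = s
      · simp [hts]
      · simp [hts]
    simp [this]
  rw [Matrix.mul_sum, Matrix.trace_sum, Finset.sum_filter (fun s => g s = x₁ ∧ h s = x₂)]
  refine Finset.sum_congr rfl fun s _ => ?_
  rw [Matrix.mul_smul, Matrix.trace_smul, ← Matrix.mul_kronecker_mul, Matrix.trace_kronecker,
    key, Matrix.mul_vecMulVec, Matrix.trace_vecMulVec, dotProduct_comm, hM]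
  by_cases h1 : g s = x₁ <;> by_cases h2 : h s = x₂ <;> simp [h1, h2, eq_comm]
  exact fun h3 => absurd h3.symm h2
end
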